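/- Let ε > 0 and μ > 0, and suppose φ : ℝ → ℝ is four times continuously differentiable on [-1,1], satisfies φ''''(x) = μ·φ(x) for all x ∈ [-1,1], φ(x) > 0 for all x ∈ (-1,1), and the Navier boundary conditions φ(1) = φ(-1) = φ''(1) = φ''(-1) = 0. If ε²·μ < 27/4, then there is no four times continuously differentiable function u : ℝ → ℝ with u(x) > -1 for all x ∈ [-1,1], satisfying ε²·u''''(x) + 1/(1+u(x))² = 0 for all x ∈ [-1,1] and the Navier boundary conditions u(1) = u(-1) = u''(1) = u''(-1) = 0. -/

import Mathlib

open Set in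
/-- The iterated derivatives of a function of class `C^n` within `[a, b]` differentiate into each
other at interior points. -/
theorem ContDiffOn.hasDerivAt_iteratedDerivWithin_Icc {f : ℝ → ℝ} {a b x : ℝ} {n k : ℕ}
    (hf : ContDiffOn ℝ n f (Icc a b)) (hk : k < n) (hx : x ∈ Ioo a b) :
    HasDerivAt (iteratedDerivWithin k f (Icc a b)) (iteratedDerivWithin (k + 1) f (Icc a b) x) x := by
  have hab : a < b := hx.1.trans hx.2
  have h := hf.differentiableOn_iteratedDerivWithin (m := k) (by exact_mod_cast hk)
    (uniqueDiffOn_Icc hab) x (Ioo_subset_Icc_self hx)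
  rw [iteratedDerivWithin_succ]
  exact h.hasDerivWithinAt.hasDerivAt (Icc_mem_nhds hx.1 hx.2)

open Set in
/-- Green's identity for the fourth derivative under Navier boundary conditions, in mean value
form. -/
theorem exists_mul_iteratedDerivWithin_four_eq {f g : ℝ → ℝ} {a b : ℝ} (hab : a < b)
    (hf : ContDiffOn ℝ 4 f (Icc a b)) (hg : ContDiffOn ℝ 4 g (Icc a b))
    (hfa : f a = 0) (hfb : f b = 0) (hga : g a = 0) (hgb : g b = 0)
    (hfa2 : iteratedDerivWithin 2 f (Icc a b) a = 0)
    (hfb2 : iteratedDerivWithin 2 f (Icc a b) b = 0)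
    (hga2 : iteratedDerivWithin 2 g (Icc a b) a = 0)
    (hgb2 : iteratedDerivWithin 2 g (Icc a b) b = 0) :
    ∃ c ∈ Ioo a b, iteratedDerivWithin 4 f (Icc a b) c * g c =
      f c * iteratedDerivWithin 4 g (Icc a b) c := by
  have hcont {h : ℝ → ℝ} (hh : ContDiffOn ℝ 4 h (Icc a b)) (k : ℕ) (hk : k ≤ 4) :
      ContinuousOn (iteratedDerivWithin k h (Icc a b)) (Icc a b) :=
    hh.continuousOn_iteratedDerivWithin (by exact_mod_cast hk) (uniqueDiffOn_Icc hab)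
  obtain ⟨F, hF⟩ : ∃ F : ℕ → ℝ → ℝ, F = fun k => iteratedDerivWithin k f (Icc a b) := ⟨_, rfl⟩
  obtain ⟨G, hG⟩ : ∃ G : ℕ → ℝ → ℝ, G = fun k => iteratedDerivWithin k g (Icc a b) := ⟨_, rfl⟩
  have hF0 : F 0 = f := by simp [hF]
  have hG0 : G 0 = g := by simp [hG]
  have hFc (k : ℕ) (hk : k ≤ 4) : ContinuousOn (F k) (Icc a b) := hF ▸ hcont hf k hk
  have hGc (k : ℕ) (hk : k ≤ 4) : ContinuousOn (G k) (Icc a b) := hG ▸ hcont hg k hk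
  have hFd (k : ℕ) (hk : k < 4) (x : ℝ) (hx : x ∈ Ioo a b) :
      HasDerivAt (F k) (F (k + 1) x) x := by
    rw [hF]; exact ContDiffOn.hasDerivAt_iteratedDerivWithin_Icc (n := 4) hf hk hx
  have hGd (k : ℕ) (hk : k < 4) (x : ℝ) (hx : x ∈ Ioo a b) :
      HasDerivAt (G k) (G (k + 1) x) x := by
    rw [hG]; exact ContDiffOn.hasDerivAt_iteratedDerivWithin_Icc (n := 4) hg hk hx
  have hFa2 : F 2 a = 0 := by rw [hF]; exact hfa2
  have hFb2 : F 2 b = 0 := by rw [hF]; exact hfb2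
  have hGa2 : G 2 a = 0 := by rw [hG]; exact hga2
  have hGb2 : G 2 b = 0 := by rw [hG]; exact hgb2
  obtain ⟨c, hc, h⟩ := exists_hasDerivAt_eq_zero
    (f := F 3 * G 0 - F 2 * G 1 + F 1 * G 2 - F 0 * G 3)
    (f' := fun x => F 4 x * G 0 x - F 0 x * G 4 x) hab
    (((((hFc 3 (by norm_num)).mul (hGc 0 (by norm_num))).sub
      ((hFc 2 (by norm_num)).mul (hGc 1 (by norm_num)))).add
      ((hFc 1 (by norm_num)).mul (hGc 2 (by norm_num)))).sub
      ((hFc 0 (by norm_num)).mul (hGc 3 (by norm_num))))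
    (by simp [hF0, hG0, hfa, hfb, hga, hgb, hFa2, hFb2, hGa2, hGb2])
    (fun x hx => by
      have hFx k hk := hFd k hk x hx
      have hGx k hk := hGd k hk x hx
      refine (((((hFx 3 (by norm_num)).mul (hGx 0 (by norm_num))).sub
        ((hFx 2 (by norm_num)).mul (hGx 1 (by norm_num)))).add
        ((hFx 1 (by norm_num)).mul (hGx 2 (by norm_num)))).sub
        ((hFx 0 (by norm_num)).mul (hGx 3 (by norm_num)))).congr_deriv ?_
      norm_num
      ring)
  refine ⟨c, hc, ?_⟩
  rw [hF0, hG0, sub_eq_zero, hF, hG] at h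
  exact h

/-- Below the critical value `27 / 4`, the MEMS nonlinearity dominates the linear term. -/
theorem mul_add_one_div_one_add_sq_pos {l v : ℝ} (hl : 0 < l) (hl' : l < 27 / 4) (hv : -1 < v) :
    0 < l * v + 1 / (1 + v) ^ 2 := by
  have hw : 0 < 1 + v := by linarith
  have hcubic : -(4 / 27) ≤ v * (1 + v) ^ 2 := by
    nlinarith [mul_nonneg (show 0 ≤ v + 4 / 3 by linarith) (sq_nonneg (v + 1 / 3))]
  have hnum : 0 < l * (v * (1 + v) ^ 2) + 1 := by
    nlinarith [mul_le_mul_of_nonneg_left hcubic hl.le]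
  have h : l * v + 1 / (1 + v) ^ 2 = (l * (v * (1 + v) ^ 2) + 1) / (1 + v) ^ 2 := by
    field_simp
  rw [h]
  positivity


/-- Nonexistence of equilibrium solutions of the MEMS equation
`ε² u'''' + 1/(1+u)² = 0` on the strip `[-1,1]` with Navier boundary
conditions, given a positive Navier biharmonic eigenpair `(φ, μ)` with
`ε² μ < 27/4`. -/
theorem no_equilibrium_navier (ε μ : ℝ) (hε : 0 < ε) (hμ : 0 < μ)
    (φ : ℝ → ℝ)
    (hφC : ContDiffOn ℝ 4 φ (Set.Icc (-1) 1))
    (hφeq : ∀ x ∈ Set.Icc (-1 : ℝ) 1,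
      iteratedDerivWithin 4 φ (Set.Icc (-1) 1) x = μ * φ x)
    (hφpos : ∀ x ∈ Set.Ioo (-1 : ℝ) 1, 0 < φ x)
    (hφ1 : φ 1 = 0) (hφm1 : φ (-1) = 0)
    (hφ''1 : iteratedDerivWithin 2 φ (Set.Icc (-1) 1) 1 = 0)
    (hφ''m1 : iteratedDerivWithin 2 φ (Set.Icc (-1) 1) (-1) = 0)
    (hεμ : ε ^ 2 * μ < 27 / 4) :
    ¬ ∃ u : ℝ → ℝ,
      ContDiffOn ℝ 4 u (Set.Icc (-1) 1) ∧
      (∀ x ∈ Set.Icc (-1 : ℝ) 1, -1 < u x) ∧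
      (∀ x ∈ Set.Icc (-1 : ℝ) 1,
        ε ^ 2 * iteratedDerivWithin 4 u (Set.Icc (-1) 1) x
          + 1 / (1 + u x) ^ 2 = 0) ∧
      u 1 = 0 ∧ u (-1) = 0 ∧
      iteratedDerivWithin 2 u (Set.Icc (-1) 1) 1 = 0 ∧
      iteratedDerivWithin 2 u (Set.Icc (-1) 1) (-1) = 0 := by
  rintro ⟨u, huC, hu, hueq, hu1, hum1, hu''1, hu''m1⟩
  obtain ⟨c, hc, h⟩ := exists_mul_iteratedDerivWithin_four_eq (by norm_num) huC hφC
    hum1 hu1 hφm1 hφ1 hu''m1 hu''1 hφ''m1 hφ''1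
  have hc' := Set.Ioo_subset_Icc_self hc
  rw [hφeq c hc'] at h
  have hφc := hφpos c hc
  have hfour : iteratedDerivWithin 4 u (Set.Icc (-1) 1) c = μ * u c :=
    mul_right_cancel₀ hφc.ne' (by linarith)
  have heq := hueq c hc'
  rw [hfour] at heq
  have hpos := mul_add_one_div_one_add_sq_pos (by positivity) hεμ (hu c hc')
  linarith
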